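/- Let Ω ⊆ ℝ^d be a bounded Lipschitz domain. Then there exists a sequence of maps Ψ_k : ℝ^d → ℝ^d of class C^∞ such that each Ψ_k is injective on cl(Ω), Ψ_k(cl(Ω)) ⊆ Ω (so in particular the closure of Ψ_k(Ω) is a compact subset of Ω), and, as k → ∞, sup_{x ∈ cl(Ω)} |Ψ_k(x) − x| → 0 and sup_{x ∈ cl(Ω)} ‖DΨ_k(x) − Id‖ → 0 (i.e., Ψ_k → id in W^{1,∞} on cl(Ω)). -/

import Mathlib

open Filter

/-- The open cylinder at `p` in direction `ν` with radius/height `ε`: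
`{p + x' + tν : x' ⊥ ν, |x'| < ε, |t| < ε}`. -/
def LipCylinder {d : ℕ} (p ν : EuclideanSpace ℝ (Fin d)) (ε : ℝ) :
    Set (EuclideanSpace ℝ (Fin d)) :=
  {q | ∃ x' ∈ (ℝ ∙ ν)ᗮ, ∃ t : ℝ, ‖x'‖ < ε ∧ |t| < ε ∧ q = p + x' + t • ν}

/-- `Ω ⊆ ℝ^d` is a (strong) bounded Lipschitz domain: it is open, connected, bounded,
and near every boundary point the boundary is the graph of a Lipschitz function,
with `Ω` lying locally below the graph. -/
def IsLipschitzDomain {d : ℕ} (Ω : Set (EuclideanSpace ℝ (Fin d))) : Prop :=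
  IsOpen Ω ∧ IsConnected Ω ∧ Bornology.IsBounded Ω ∧
    ∀ p ∈ frontier Ω,
      ∃ (ε : ℝ) (ν : EuclideanSpace ℝ (Fin d))
        (g : EuclideanSpace ℝ (Fin d) → ℝ) (L : NNReal),
        0 < ε ∧ ‖ν‖ = 1 ∧ g 0 = 0 ∧
        LipschitzOnWith L g {x' | x' ∈ (ℝ ∙ ν)ᗮ ∧ ‖x'‖ < ε} ∧
        (∀ x' ∈ (ℝ ∙ ν)ᗮ, ‖x'‖ < ε → |g x'| < ε) ∧
        Ω ∩ LipCylinder p ν ε =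
          {q | ∃ x' ∈ (ℝ ∙ ν)ᗮ, ∃ t : ℝ, ‖x'‖ < ε ∧ -ε < t ∧ t < g x' ∧ q = p + x' + t • ν} ∧
        frontier Ω ∩ LipCylinder p ν ε =
          {q | ∃ x' ∈ (ℝ ∙ ν)ᗮ, ‖x'‖ < ε ∧ q = p + x' + g x' • ν}

/-- Near a boundary point of a Lipschitz domain, points of the closure are pushed into the
domain by small positive multiples of a fixed unit vector. -/
lemma IsLipschitzDomain.exists_inward_direction {d : ℕ} {Ω : Set (EuclideanSpace ℝ (Fin d))}
    (hΩ : IsLipschitzDomain Ω) {p : EuclideanSpace ℝ (Fin d)} (hp : p ∈ frontier Ω) :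
    ∃ (r : ℝ) (v : EuclideanSpace ℝ (Fin d)), 0 < r ∧
      ∀ y ∈ closure Ω, dist y p < r → ∀ s, 0 < s → s < r → y + s • v ∈ Ω := by
  obtain ⟨ε, ν, g, L, hε, hν, -, -, -, hin, hbd⟩ := hΩ.2.2.2 p hp
  have hνν : inner ℝ ν ν = 1 := by rw [real_inner_self_eq_norm_sq, hν, one_pow]
  refine ⟨ε / 2, -ν, by positivity, fun y hy hyp s hs hs' => ?_⟩
  rw [dist_eq_norm] at hyp
  have habs : |inner ℝ ν (y - p)| ≤ ‖y - p‖ := by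
    simpa [hν] using abs_real_inner_le_norm ν (y - p)
  have hcyl : y ∈ LipCylinder p ν ε := by
    refine ⟨(y - p) - (inner ℝ ν (y - p) : ℝ) • ν, ?_, inner ℝ ν (y - p), ?_, by linarith,
      by abel⟩
    · rw [Submodule.mem_orthogonal_singleton_iff_inner_right, inner_sub_right, inner_smul_right,
        hνν]
      ring
    · calc _ ≤ ‖y - p‖ + ‖(inner ℝ ν (y - p) : ℝ) • ν‖ := norm_sub_le _ _
        _ ≤ ‖y - p‖ + ‖y - p‖ := by rw [norm_smul, hν, mul_one, Real.norm_eq_abs]; gcongr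
        _ < ε := by linarith
  have key : ∃ x' ∈ (ℝ ∙ ν)ᗮ, ∃ t : ℝ, ‖x'‖ < ε ∧ t ≤ g x' ∧ y = p + x' + t • ν := by
    rw [closure_eq_self_union_frontier] at hy
    rcases hy with hy | hy
    · obtain ⟨x', hx', t, hxε, -, ht, rfl⟩ := hin.subset ⟨hy, hcyl⟩
      exact ⟨x', hx', t, hxε, ht.le, rfl⟩
    · obtain ⟨x', hx', hxε, rfl⟩ := hbd.subset ⟨hy, hcyl⟩
      exact ⟨x', hx', g x', hxε, le_rfl, rfl⟩
  obtain ⟨x', hx', t, hxε, ht, rfl⟩ := key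
  have hinner : inner ℝ ν (p + x' + t • ν - p) = t := by
    rw [show p + x' + t • ν - p = x' + t • ν by abel, inner_add_right,
      Submodule.mem_orthogonal_singleton_iff_inner_right.1 hx', inner_smul_right, hνν]
    ring
  rw [hinner] at habs
  have := neg_abs_le t
  exact (hin.superset ⟨x', hx', t - s, hxε, by linarith, by linarith, by module⟩).1

/-- A Lipschitz domain admits a smooth compactly supported vector field `V` such that a small
positive multiple of `V` maps the closure of the domain into the domain. -/
lemma IsLipschitzDomain.exists_inward_vectorField {d : ℕ} {Ω : Set (EuclideanSpace ℝ (Fin d))}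
    (hΩ : IsLipschitzDomain Ω) :
    ∃ V : EuclideanSpace ℝ (Fin d) → EuclideanSpace ℝ (Fin d),
      ContDiff ℝ (⊤ : ℕ∞) V ∧ HasCompactSupport V ∧
      ∃ δ > 0, ∀ x ∈ closure Ω, ∀ t : ℝ, 0 < t → t < δ → x + t • V x ∈ Ω := by
  have hcompact : IsCompact (frontier Ω) :=
    hΩ.2.2.1.isCompact_closure.of_isClosed_subset isClosed_frontier frontier_subset_closure
  have main : ∃ V : EuclideanSpace ℝ (Fin d) → EuclideanSpace ℝ (Fin d),
      ContDiff ℝ (⊤ : ℕ∞) V ∧ HasCompactSupport V ∧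
      ∃ δ > 0, ∀ x, ∀ y ∈ closure Ω, dist y x < δ → ∀ t : ℝ, 0 < t → t < δ →
        y + t • V x ∈ closure Ω ∧ (y ∈ Ω ∨ x ∈ frontier Ω → y + t • V x ∈ Ω) := by
    refine hcompact.induction_on (p := fun s => ∃ V : EuclideanSpace ℝ (Fin d) → _,
      ContDiff ℝ (⊤ : ℕ∞) V ∧ HasCompactSupport V ∧
      ∃ δ > 0, ∀ x, ∀ y ∈ closure Ω, dist y x < δ → ∀ t : ℝ, 0 < t → t < δ →
        y + t • V x ∈ closure Ω ∧ (y ∈ Ω ∨ x ∈ s → y + t • V x ∈ Ω)) ?_ ?_ ?_ ?_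
    · refine ⟨fun _ => 0, contDiff_const, HasCompactSupport.zero, 1, one_pos, ?_⟩
      intro x y hy _ t _ _
      simpa using hy
    · rintro s s' hss ⟨V, hV, hVc, δ, hδ, h⟩
      exact ⟨V, hV, hVc, δ, hδ, fun x y hy hd t ht ht' =>
        ⟨(h x y hy hd t ht ht').1, fun hx => (h x y hy hd t ht ht').2 (hx.imp_right (@hss x))⟩⟩
    · rintro s s' ⟨V, hV, hVc, δ, hδ, h⟩ ⟨W, hW, hWc, δ', hδ', h'⟩
      obtain ⟨C, hC⟩ := hVc.exists_bound_of_continuous hV.continuous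
      have hC0 : 0 ≤ C := (norm_nonneg _).trans (hC 0)
      refine ⟨fun x => V x + W x, hV.add hW, hVc.add hWc,
        min δ (δ' / (2 * (C + 1))), by positivity, fun x y hy hd t ht ht' => ?_⟩
      obtain ⟨hd1, hd2⟩ := lt_min_iff.1 hd
      obtain ⟨ht1, ht2⟩ := lt_min_iff.1 ht'
      rw [lt_div_iff₀ (by positivity)] at hd2 ht2
      have hdist : 0 ≤ dist y x := dist_nonneg
      have hy' := h x y hy hd1 t ht ht1
      have hd' : dist (y + t • V x) x < δ' := by
        calc dist (y + t • V x) x ≤ dist (y + t • V x) y + dist y x := dist_triangle _ _ _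
          _ = t * ‖V x‖ + dist y x := by
            rw [dist_eq_norm, add_sub_cancel_left, norm_smul, Real.norm_of_nonneg ht.le]
          _ ≤ t * C + dist y x := by gcongr; exact hC x
          _ < δ' := by nlinarith [mul_nonneg hdist hC0]
      have hz := h' x _ hy'.1 hd' t ht (by nlinarith [mul_nonneg ht.le hC0])
      rw [smul_add, ← add_assoc]
      refine ⟨hz.1, ?_⟩
      rintro (hx | hx | hx)
      · exact hz.2 (.inl (hy'.2 (.inl hx)))
      · exact hz.2 (.inl (hy'.2 (.inr hx)))
      · exact hz.2 (.inr hx)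
    · intro p hp
      obtain ⟨r, v, hr, h⟩ := hΩ.exists_inward_direction hp
      let φ : ContDiffBump p := ⟨r / 4, r / 2, by positivity, by linarith⟩
      refine ⟨Metric.ball p (r / 4),
        mem_nhdsWithin_of_mem_nhds (Metric.ball_mem_nhds p (by positivity)),
        fun x => φ x • v, φ.contDiff.smul contDiff_const, φ.hasCompactSupport.smul_right,
        r / 2, by positivity, fun x y hy hd t ht ht' => ?_⟩
      by_cases hx : x ∈ Metric.ball p (r / 2)
      · have hpos : 0 < φ x := φ.pos_of_mem_ball hx
        have hmem : y + t • φ x • v ∈ Ω := by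
          rw [smul_smul]
          refine h y hy ?_ _ (by positivity) ?_
          · have := dist_triangle y x p
            rw [Metric.mem_ball] at hx
            linarith
          · nlinarith [φ.le_one (x := x)]
        exact ⟨subset_closure hmem, fun _ => hmem⟩
      · have hzero : φ x = 0 := φ.zero_of_le_dist (by simpa using hx)
        refine ⟨by simpa [hzero] using hy, ?_⟩
        rintro (hyΩ | hxs)
        · simpa [hzero] using hyΩ
        · exact absurd (Metric.ball_subset_ball (by linarith) hxs) hx
  obtain ⟨V, hV, hVc, δ, hδ, h⟩ := main
  refine ⟨V, hV, hVc, δ, hδ, fun x hx t ht ht' =>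
    (h x x hx (by simpa using hδ) t ht ht').2 ?_⟩
  rwa [closure_eq_self_union_frontier] at hx

/-- On a bounded Lipschitz domain `Ω` there is a sequence of smooth maps `Ψ k : ℝ^d → ℝ^d`,
injective on `cl(Ω)`, mapping `cl(Ω)` into `Ω` (so `cl(Ψ k '' Ω)` is a compact subset
of `Ω`), with `Ψ k → id` and `DΨ k → Id` uniformly on `cl(Ω)` (i.e. `Ψ k → id` in
`W^{1,∞}` on `cl(Ω)`). -/
theorem exists_smooth_inner_shrinking {d : ℕ}
    (Ω : Set (EuclideanSpace ℝ (Fin d))) (hΩ : IsLipschitzDomain Ω) :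
    ∃ Ψ : ℕ → EuclideanSpace ℝ (Fin d) → EuclideanSpace ℝ (Fin d),
      (∀ k, ContDiff ℝ (⊤ : ℕ∞) (Ψ k)) ∧
      (∀ k, Set.InjOn (Ψ k) (closure Ω)) ∧
      (∀ k, Ψ k '' (closure Ω) ⊆ Ω) ∧
      (∀ k, IsCompact (closure (Ψ k '' Ω)) ∧ closure (Ψ k '' Ω) ⊆ Ω) ∧
      TendstoUniformlyOn Ψ id atTop (closure Ω) ∧
      TendstoUniformlyOn (fun k x => fderiv ℝ (Ψ k) x)
        (fun _ => ContinuousLinearMap.id ℝ (EuclideanSpace ℝ (Fin d)))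
        atTop (closure Ω) := by
  obtain ⟨V, hV, hVc, δ, hδ, hin⟩ := hΩ.exists_inward_vectorField
  have hVd : Differentiable ℝ V := hV.differentiable (by simp)
  obtain ⟨B, hB⟩ := hVc.exists_bound_of_continuous hV.continuous
  obtain ⟨C, hC⟩ := (hVc.fderiv ℝ).exists_bound_of_continuous (hV.continuous_fderiv (by simp))
  have hC0 : 0 ≤ C := (norm_nonneg _).trans (hC 0)
  have hlip : ∀ x y, ‖V y - V x‖ ≤ C * ‖y - x‖ := fun x y =>
    convex_univ.norm_image_sub_le_of_norm_fderiv_le (fun z _ => hVd z) (fun z _ => hC z)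
      (Set.mem_univ x) (Set.mem_univ y)
  set c : ℝ := min (δ / 2) (1 / (2 * (C + 1)))
  have hc0 : 0 < c := by positivity
  let t : ℕ → ℝ := fun k => c * (1 / ((k : ℝ) + 1))
  have ht0 : ∀ k, 0 < t k := fun k => by positivity
  have htc : ∀ k, t k ≤ c := fun k => by
    refine mul_le_of_le_one_right hc0.le ?_
    rw [div_le_one (by positivity)]
    linarith [(Nat.cast_nonneg k : (0 : ℝ) ≤ k)]
  have htδ : ∀ k, t k < δ := fun k => by
    linarith [htc k, min_le_left (δ / 2) (1 / (2 * (C + 1)))]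
  have htC : ∀ k, t k * C < 1 := fun k => by
    have h1 := (htc k).trans (min_le_right _ _)
    rw [le_div_iff₀ (by positivity)] at h1
    nlinarith [ht0 k]
  have ht : Tendsto t atTop (nhds 0) := by
    simpa [t] using (tendsto_one_div_add_atTop_nhds_zero_nat (𝕜 := ℝ)).const_mul c
  have hsmall : ∀ M ε : ℝ, 0 < ε → ∀ᶠ k in atTop, t k * M < ε := fun M ε hε => by
    have h1 : Tendsto (fun k => t k * M) atTop (nhds 0) := by simpa using ht.mul_const M
    exact h1.eventually_lt_const hε
  have hsmooth : ∀ k, ContDiff ℝ (⊤ : ℕ∞) (fun x => x + t k • V x) := fun k =>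
    contDiff_id.add (hV.const_smul (t k))
  have himage : ∀ k, (fun x => x + t k • V x) '' closure Ω ⊆ Ω := by
    rintro k _ ⟨x, hx, rfl⟩
    exact hin x hx _ (ht0 k) (htδ k)
  have hcpt : ∀ k, IsCompact ((fun x => x + t k • V x) '' closure Ω) := fun k =>
    hΩ.2.2.1.isCompact_closure.image (hsmooth k).continuous
  have hclos : ∀ k, closure ((fun x => x + t k • V x) '' Ω) ⊆
      (fun x => x + t k • V x) '' closure Ω := fun k =>
    closure_minimal (Set.image_mono subset_closure) (hcpt k).isClosed
  refine ⟨fun k x => x + t k • V x, hsmooth, fun k x _ y _ hxy => ?_, himage,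
    fun k => ⟨(hcpt k).of_isClosed_subset isClosed_closure (hclos k), (hclos k).trans (himage k)⟩,
    ?_, ?_⟩
  · have heq : y - x = -(t k • (V y - V x)) := by
      have hxy' : x + t k • V x = y + t k • V y := hxy
      rw [smul_sub, neg_sub, sub_eq_sub_iff_add_eq_add, ← hxy', add_comm]
    have hle : ‖y - x‖ ≤ t k * C * ‖y - x‖ := by
      calc ‖y - x‖ = t k * ‖V y - V x‖ := by
            conv_lhs => rw [heq, norm_neg, norm_smul, Real.norm_of_nonneg (ht0 k).le]
        _ ≤ t k * (C * ‖y - x‖) := mul_le_mul_of_nonneg_left (hlip x y) (ht0 k).le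
        _ = _ := by ring
    have hzero : ‖y - x‖ = 0 := by nlinarith [norm_nonneg (y - x), htC k]
    exact (sub_eq_zero.1 (norm_eq_zero.1 hzero)).symm
  · rw [Metric.tendstoUniformlyOn_iff]
    intro ε hε
    filter_upwards [hsmall B ε hε] with k hk x _
    rw [id, dist_eq_norm, sub_add_cancel_left, norm_neg, norm_smul,
      Real.norm_of_nonneg (ht0 k).le]
    exact (mul_le_mul_of_nonneg_left (hB x) (ht0 k).le).trans_lt hk
  · rw [Metric.tendstoUniformlyOn_iff]
    intro ε hε
    filter_upwards [hsmall C ε hε] with k hk x _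
    have hder : fderiv ℝ (fun x => x + t k • V x) x =
        ContinuousLinearMap.id ℝ _ + t k • fderiv ℝ V x :=
      ((hasFDerivAt_id x).add ((hVd x).hasFDerivAt.const_smul (t k))).fderiv
    rw [hder, dist_eq_norm, sub_add_cancel_left, norm_neg, norm_smul,
      Real.norm_of_nonneg (ht0 k).le]
    exact (mul_le_mul_of_nonneg_left (hC x) (ht0 k).le).trans_lt hk
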